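/- arXiv:2010.04320 — 5 statements merged into one kernel-verified Lean document; each statement's English description precedes it below -/
import Mathlib

section
/- Let h₁, h₂ be quaternions with ‖h₁‖ = 1 and ‖h₂‖ = 1. Then h₁ * h₂ * h₁⁻¹ * h₂⁻¹ = −1 if and only if Re(h₁) = 0, Re(h₂) = 0, and Re(h₁ * h₂) = 0. -/
noncomputable section

/-- In a group with zero carrying a distributive negation, a commutator of nonzero elements is `-1`
iff the elements anticommute. -/
theorem mul_mul_inv_mul_inv_eq_neg_one_iff {G : Type*} [GroupWithZero G] [HasDistribNeg G]
    {a b : G} (ha : a ≠ 0) (hb : b ≠ 0) :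
    a * b * a⁻¹ * b⁻¹ = -1 ↔ a * b = -(b * a) := by
  rw [mul_inv_eq_iff_eq_mul₀ hb, mul_inv_eq_iff_eq_mul₀ ha, neg_one_mul, neg_mul]

/-- The squared norm of a unit quaternion in coordinates. -/
theorem Quaternion.sum_sq_eq_one_of_norm_eq_one {q : Quaternion ℝ} (hq : ‖q‖ = 1) :
    q.re ^ 2 + q.imI ^ 2 + q.imJ ^ 2 + q.imK ^ 2 = 1 := by
  rw [← Quaternion.normSq_def', Quaternion.normSq_eq_norm_mul_self, hq, mul_one]

/-- Two unit quaternions anticommute (i.e. have commutator `-1`)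
iff both are traceless and their product is traceless. -/
theorem commutator_eq_negOne_iff (h₁ h₂ : Quaternion ℝ)
    (hn₁ : ‖h₁‖ = 1) (hn₂ : ‖h₂‖ = 1) :
    h₁ * h₂ * h₁⁻¹ * h₂⁻¹ = -1 ↔ h₁.re = 0 ∧ h₂.re = 0 ∧ (h₁ * h₂).re = 0 := by
  have h₁0 : h₁ ≠ 0 := norm_ne_zero_iff.mp (by simp [hn₁])
  have h₂0 : h₂ ≠ 0 := norm_ne_zero_iff.mp (by simp [hn₂])
  have e₁ := Quaternion.sum_sq_eq_one_of_norm_eq_one hn₁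
  have e₂ := Quaternion.sum_sq_eq_one_of_norm_eq_one hn₂
  rw [mul_mul_inv_mul_inv_eq_neg_one_iff h₁0 h₂0]
  constructor
  · intro h
    have hr := congrArg QuaternionAlgebra.re h
    have hi := congrArg QuaternionAlgebra.imI h
    have hj := congrArg QuaternionAlgebra.imJ h
    have hk := congrArg QuaternionAlgebra.imK h
    simp only [Quaternion.re_mul, Quaternion.imI_mul, Quaternion.imJ_mul, Quaternion.imK_mul,
      Quaternion.re_neg, Quaternion.imI_neg, Quaternion.imJ_neg, Quaternion.imK_neg]
      at hr hi hj hk ⊢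
    refine ⟨?_, ?_, by linarith⟩
    · linear_combination (-h₁.re) * e₂ +
        (h₂.re * hr + h₂.imI * hi + h₂.imJ * hj + h₂.imK * hk) / 2
    · linear_combination (-h₂.re) * e₁ +
        (h₁.re * hr + h₁.imI * hi + h₁.imJ * hj + h₁.imK * hk) / 2
  · rintro ⟨r₁, r₂, hr⟩
    rw [Quaternion.re_mul, r₁, r₂] at hr
    ext <;>
      simp only [Quaternion.re_mul, Quaternion.imI_mul, Quaternion.imJ_mul, Quaternion.imK_mul,
        Quaternion.re_neg, Quaternion.imI_neg, Quaternion.imJ_neg, Quaternion.imK_neg, r₁, r₂] <;>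
      linarith
end
end

section
/- For all real numbers γ, θ, ν: if sin γ * cos ν + sin θ * sin ν = 0, then the triple of partial derivatives (cos γ * cos ν, cos θ * sin ν, sin θ * cos ν − sin γ * sin ν) is not equal to (0, 0, 0). In other words, 0 is a regular value of the function (γ, θ, ν) ↦ sin γ * cos ν + sin θ * sin ν. -/
/-- `0` is a regular value of
`(γ, θ, ν) ↦ sin γ * cos ν + sin θ * sin ν`: at every zero, the triple of partial
derivatives is nonzero. -/
theorem zero_is_regular_value (γ θ ν : ℝ)
    (hzero : Real.sin γ * Real.cos ν + Real.sin θ * Real.sin ν = 0) :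
    (Real.cos γ * Real.cos ν, Real.cos θ * Real.sin ν,
      Real.sin θ * Real.cos ν - Real.sin γ * Real.sin ν) ≠ ((0 : ℝ), (0 : ℝ), (0 : ℝ)) := by
  intro h
  simp only [Prod.mk.injEq] at h
  obtain ⟨hγ, hθ, hν⟩ := h
  have hsq := Real.sin_sq_add_cos_sq ν
  have sin_γ : Real.sin γ = 0 := by
    linear_combination Real.cos ν * hzero - Real.sin ν * hν - Real.sin γ * hsq
  have sin_θ : Real.sin θ = 0 := by
    linear_combination Real.sin ν * hzero + Real.cos ν * hν - Real.sin θ * hsq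
  have cos_γ : Real.cos γ ≠ 0 := by
    intro h
    simpa [sin_γ, h] using Real.sin_sq_add_cos_sq γ
  have cos_θ : Real.cos θ ≠ 0 := by
    intro h
    simpa [sin_θ, h] using Real.sin_sq_add_cos_sq θ
  have cos_ν : Real.cos ν = 0 := (mul_eq_zero.mp hγ).resolve_left cos_γ
  have sin_ν : Real.sin ν = 0 := (mul_eq_zero.mp hθ).resolve_left cos_θ
  simp [sin_ν, cos_ν] at hsq
end

section
/- Let g, h : ℝ → ℝ be continuously differentiable functions with g(t) > 0 and g'(t)² + g(t)² * h'(t) > 0 for all t. Define Θ : ℝ² → ℂ × ℂ by Θ(t, ν) = (g(t) * e^{iν}, g(t) * e^{i(ν + h(t))}). Then for every (t, ν): (1) the partial derivatives ∂Θ/∂t and ∂Θ/∂ν are linearly independent over ℝ (so Θ is an immersion), and (2) Im(conj(∂Θ₁/∂t) * ∂Θ₁/∂ν) = Im(conj(∂Θ₂/∂t) * ∂Θ₂/∂ν), where Θ = (Θ₁, Θ₂); i.e. the pullback under Θ of the split symplectic form (−ω₀) ⊕ ω₀ on ℂ × ℂ vanishes, so Θ is a Lagrangian immersion. -/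
noncomputable section
open Complex

/-- The derivative of a curve in polar form `r(s)e^{iφ(s)}`. -/
theorem hasDerivAt_polar {r φ : ℝ → ℝ} {r' φ' s : ℝ} (hr : HasDerivAt r r' s)
    (hφ : HasDerivAt φ φ' s) :
    HasDerivAt (fun s => (r s : ℂ) * Complex.exp ((φ s : ℝ) * Complex.I))
      (((r' : ℂ) + (r s * φ' : ℝ) * Complex.I) * Complex.exp ((φ s : ℝ) * Complex.I)) s := by
  refine (hr.ofReal_comp.mul (hφ.ofReal_comp.mul_const Complex.I).cexp).congr_deriv ?_
  push_cast
  ring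

/-- Multiplying both arguments by the same unit complex number preserves `conj z * w`. -/
theorem conj_mul_exp_mul_I (z w : ℂ) (θ : ℝ) :
    (starRingEnd ℂ) (z * Complex.exp (θ * Complex.I)) * (w * Complex.exp (θ * Complex.I)) =
      (starRingEnd ℂ) z * w := by
  have h : (starRingEnd ℂ) (Complex.exp (θ * Complex.I)) * Complex.exp (θ * Complex.I) = 1 := by
    rw [← Complex.normSq_eq_conj_mul_self, Complex.normSq_eq_norm_sq,
      Complex.norm_exp_ofReal_mul_I]
    simp
  rw [map_mul]
  linear_combination (starRingEnd ℂ) z * w * h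

/-- The model map `Θ(t, ν) = (g(t)e^{iν}, g(t)e^{i(ν + h(t))})` is a
Lagrangian immersion of `ℝ²` into `ℂ⁻ × ℂ`: its two partial derivatives are linearly
independent over `ℝ`, and the pullback of the split symplectic form `(-ω₀) ⊕ ω₀`
vanishes. -/
theorem model_map_is_lagrangian_immersion (g h : ℝ → ℝ)
    (hg : ContDiff ℝ 1 g) (hh : ContDiff ℝ 1 h)
    (hgpos : ∀ t, 0 < g t)
    (hreg : ∀ t, 0 < (deriv g t) ^ 2 + (g t) ^ 2 * deriv h t) :
    ∀ t ν : ℝ,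
      let Θ₁ : ℝ → ℝ → ℂ := fun t ν => (g t : ℂ) * Complex.exp (ν * Complex.I)
      let Θ₂ : ℝ → ℝ → ℂ := fun t ν => (g t : ℂ) * Complex.exp ((ν + h t : ℝ) * Complex.I)
      let Dt : ℂ × ℂ := (deriv (fun s => Θ₁ s ν) t, deriv (fun s => Θ₂ s ν) t)
      let Dν : ℂ × ℂ := (deriv (fun s => Θ₁ t s) ν, deriv (fun s => Θ₂ t s) ν)
      LinearIndependent ℝ ![Dt, Dν] ∧
      ((starRingEnd ℂ) Dt.1 * Dν.1).im = ((starRingEnd ℂ) Dt.2 * Dν.2).im := by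
  intro t ν Θ₁ Θ₂ Dt Dν
  have hg' : HasDerivAt g (deriv g t) t := (hg.differentiable one_ne_zero t).hasDerivAt
  have hh' : HasDerivAt h (deriv h t) t := (hh.differentiable one_ne_zero t).hasDerivAt
  have hDt : Dt = (
      (((deriv g t : ℝ) : ℂ) + (g t * 0 : ℝ) * Complex.I) * Complex.exp (ν * Complex.I),
      (((deriv g t : ℝ) : ℂ) + (g t * deriv h t : ℝ) * Complex.I) *
        Complex.exp ((ν + h t : ℝ) * Complex.I)) :=
    Prod.ext (hasDerivAt_polar hg' (hasDerivAt_const t ν)).deriv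
      (hasDerivAt_polar hg' (hh'.const_add ν)).deriv
  have hDν : Dν = ((((0 : ℝ) : ℂ) + (g t * 1 : ℝ) * Complex.I) * Complex.exp (ν * Complex.I),
      (((0 : ℝ) : ℂ) + (g t * 1 : ℝ) * Complex.I) * Complex.exp ((ν + h t : ℝ) * Complex.I)) :=
    Prod.ext (hasDerivAt_polar (hasDerivAt_const ν (g t)) (hasDerivAt_id ν)).deriv
      (hasDerivAt_polar (hasDerivAt_const ν (g t)) ((hasDerivAt_id ν).add_const (h t))).deriv
  rw [hDt, hDν]
  refine ⟨LinearIndependent.pair_iff.2 fun a b hab => ?_, ?_⟩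
  · obtain ⟨h₁, h₂⟩ := Prod.ext_iff.1 hab
    simp only [Prod.fst_add, Prod.snd_add, Prod.smul_fst, Prod.smul_snd, Prod.fst_zero,
      Prod.snd_zero, ← smul_mul_assoc, ← add_mul, mul_eq_zero, Complex.exp_ne_zero,
      or_false] at h₁ h₂
    have h₁re := congrArg Complex.re h₁
    have h₁im := congrArg Complex.im h₁
    have h₂im := congrArg Complex.im h₂
    simp at h₁re h₁im h₂im
    have hb : b = 0 := h₁im.resolve_right (hgpos t).ne'
    refine ⟨?_, hb⟩
    by_contra ha
    have hreg_t := hreg t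
    simp [ha, hb, (hgpos t).ne'] at h₁re h₂im
    simp [h₁re, h₂im] at hreg_t
  · rw [conj_mul_exp_mul_I, conj_mul_exp_mul_I]
    simp
end
end

section
/- Let F be the free group on the eight generators w, a, b, e, f, p, q, h. In F, set λ_p := b*h, λ_q := f*a⁻¹*h, c := q⁻¹*p⁻¹*b*p*q, d := h⁻¹*a*w*h, g := q⁻¹*e*q, and m := f⁻¹*q⁻¹*f*a⁻¹*b⁻¹*p⁻¹*b. Then the element c*d*(g*f)⁻¹ lies in the normal closure in F of the set {p*λ_p*p⁻¹*λ_p⁻¹, q*λ_q*q⁻¹*λ_q⁻¹, b*a*(e*f)⁻¹, m*h*m⁻¹*h⁻¹*w⁻¹}. (That is, the Wirtinger relation c*d = g*f is a consequence of the other relations in the presentation of the earring tangle group.) -/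
namespace EarringTangle

/-- The eight generators `w, a, b, e, f, p, q, h` of the earring tangle group. -/
inductive Gen
  | w | a | b | e | f | p | q | h
  deriving DecidableEq

open FreeGroup

/-- Generators as elements of the free group. -/
def W : FreeGroup Gen := of Gen.w
def A : FreeGroup Gen := of Gen.a
def B : FreeGroup Gen := of Gen.b
def E : FreeGroup Gen := of Gen.e
def F : FreeGroup Gen := of Gen.f
def P : FreeGroup Gen := of Gen.p
def Q : FreeGroup Gen := of Gen.q
def H : FreeGroup Gen := of Gen.h

def lamP : FreeGroup Gen := B * H
def lamQ : FreeGroup Gen := F * A⁻¹ * H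
def C : FreeGroup Gen := Q⁻¹ * P⁻¹ * B * P * Q
def D : FreeGroup Gen := H⁻¹ * A * W * H
def G : FreeGroup Gen := Q⁻¹ * E * Q
def M : FreeGroup Gen := F⁻¹ * Q⁻¹ * F * A⁻¹ * B⁻¹ * P⁻¹ * B

/-- In any group, the four relations of the earring tangle group force the Wirtinger relation
`c * d = g * f`. -/
theorem wirtinger_relation_of_relations {K : Type*} [Group K] {w a b e f p q h m : K}
    (hm : m = f⁻¹ * q⁻¹ * f * a⁻¹ * b⁻¹ * p⁻¹ * b)
    (hp : Commute p (b * h)) (hq : Commute q (f * a⁻¹ * h))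
    (hef : b * a = e * f) (hw : m * h * m⁻¹ * h⁻¹ = w) :
    (q⁻¹ * p⁻¹ * b * p * q) * (h⁻¹ * a * w * h) = (q⁻¹ * e * q) * f := by
  have conj_p : (b * h)⁻¹ * p⁻¹ * (b * h) = p⁻¹ := by
    rw [mul_assoc, hp.inv_left.eq, inv_mul_cancel_left]
  have conj_q : (f * a⁻¹ * h)⁻¹ * q⁻¹ * (f * a⁻¹ * h) = q⁻¹ := by
    rw [mul_assoc, hq.inv_left.eq, inv_mul_cancel_left]
  have conj_am : h⁻¹ * (a * m) * h = q⁻¹ * p⁻¹ := by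
    calc h⁻¹ * (a * m) * h
        = ((f * a⁻¹ * h)⁻¹ * q⁻¹ * (f * a⁻¹ * h)) * ((b * h)⁻¹ * p⁻¹ * (b * h)) := by
          rw [hm]; group
      _ = q⁻¹ * p⁻¹ := by rw [conj_p, conj_q]
  have he : e = b * a * f⁻¹ := eq_mul_inv_of_mul_eq hef.symm
  calc (q⁻¹ * p⁻¹ * b * p * q) * (h⁻¹ * a * w * h)
      = q⁻¹ * p⁻¹ * b * p * q * (h⁻¹ * (a * m) * h) * m⁻¹ := by rw [← hw]; group
    _ = (q⁻¹ * e * q) * f := by rw [conj_am, he, hm]; group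

/-- The Wirtinger relation `c*d = g*f` is a consequence of the other
relations in the presentation of the earring tangle group: the relator `c*d*(g*f)⁻¹` lies
in the normal closure of the remaining four relators. -/
theorem redundant_wirtinger_relation :
    C * D * (G * F)⁻¹ ∈ Subgroup.normalClosure
      ({P * lamP * P⁻¹ * lamP⁻¹,
        Q * lamQ * Q⁻¹ * lamQ⁻¹,
        B * A * (E * F)⁻¹,
        M * H * M⁻¹ * H⁻¹ * W⁻¹} : Set (FreeGroup Gen)) := by
  set S : Set (FreeGroup Gen) := {P * lamP * P⁻¹ * lamP⁻¹,
    Q * lamQ * Q⁻¹ * lamQ⁻¹,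
    B * A * (E * F)⁻¹,
    M * H * M⁻¹ * H⁻¹ * W⁻¹} with hS
  let π := QuotientGroup.mk' (Subgroup.normalClosure S)
  have map_eq {x y : FreeGroup Gen} (hxy : x * y⁻¹ ∈ S) : π x = π y := by
    rw [← mul_inv_eq_one, ← _root_.map_inv, ← _root_.map_mul]
    exact (QuotientGroup.eq_one_iff _).2 (Subgroup.subset_normalClosure hxy)
  have hp : π (P * lamP * P⁻¹) = π lamP := map_eq (by simp [hS])
  have hq : π (Q * lamQ * Q⁻¹) = π lamQ := map_eq (by simp [hS])
  have hef : π (B * A) = π (E * F) := map_eq (by simp [hS])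
  have hw : π (M * H * M⁻¹ * H⁻¹) = π W := map_eq (by simp [hS])
  rw [← QuotientGroup.eq_one_iff]
  change π (C * D * (G * F)⁻¹) = 1
  rw [_root_.map_mul, _root_.map_inv, mul_inv_eq_one]
  simp only [lamP, lamQ, _root_.map_mul, _root_.map_inv] at hp hq hef hw
  simp only [C, D, G, _root_.map_mul, _root_.map_inv]
  exact wirtinger_relation_of_relations (m := π M) (by simp only [M, _root_.map_mul, _root_.map_inv])
    (mul_inv_eq_iff_eq_mul.1 hp) (mul_inv_eq_iff_eq_mul.1 hq) hef hw

end EarringTangle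
end

section
/- The subset Σ̂ := {(γ, θ, y, z) ∈ (ℝ/2πℤ) × (ℝ/2πℤ) × ℝ × ℝ : y² + z² = 1 and sin(γ) * z = sin(θ) * y} of (ℝ/2πℤ)² × ℝ² is path-connected. -/
/-- Any angle can be moved continuously so that its sine is scaled linearly down to zero. -/
theorem Real.Angle.exists_continuous_sin_eq_mul (γ : Real.Angle) :
    ∃ f : ℝ → Real.Angle, Continuous f ∧ f 1 = γ ∧
      ∀ t ∈ Set.Icc (0 : ℝ) 1, (f t).sin = t * γ.sin := by
  have hγ : |γ.sin| ≤ 1 := by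
    induction γ using Real.Angle.induction_on with
    | _ x => exact Real.abs_sin_le_one x
  have hs : ∀ t ∈ Set.Icc (0 : ℝ) 1, Real.sin (Real.arcsin (t * γ.sin)) = t * γ.sin := by
    intro t ht
    have h : |t * γ.sin| ≤ 1 := by
      rw [abs_mul, abs_of_nonneg ht.1]
      exact mul_le_one₀ ht.2 (abs_nonneg _) hγ
    exact Real.sin_arcsin (abs_le.1 h).1 (abs_le.1 h).2
  have hc : Continuous fun t : ℝ ↦ Real.arcsin (t * γ.sin) :=
    Real.continuous_arcsin.comp (by fun_prop)
  have h1 : γ.sin = (Real.arcsin (1 * γ.sin) : Real.Angle).sin := by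
    rw [Real.Angle.sin_coe, hs 1 (by simp), one_mul]
  rcases Real.Angle.sin_eq_iff_eq_or_add_eq_pi.1 h1 with h | h
  · exact ⟨fun t ↦ (Real.arcsin (t * γ.sin) : Real.Angle), Real.Angle.continuous_coe.comp hc,
      h.symm, hs⟩
  · refine ⟨fun t ↦ ((Real.pi - Real.arcsin (t * γ.sin) : ℝ) : Real.Angle),
      Real.Angle.continuous_coe.comp (by fun_prop), ?_, fun t ht ↦ ?_⟩
    · simp only [Real.Angle.coe_sub]
      exact (eq_sub_of_add_eq h).symm
    · simpa only [Real.Angle.sin_coe, Real.sin_pi_sub] using hs t ht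

/-- Any angle can be moved continuously to zero. -/
theorem Real.Angle.exists_continuous_zero_one (γ : Real.Angle) :
    ∃ f : ℝ → Real.Angle, Continuous f ∧ f 0 = 0 ∧ f 1 = γ := by
  induction γ using Real.Angle.induction_on with
  | _ x =>
    exact ⟨fun t ↦ ((t * x : ℝ) : Real.Angle), Real.Angle.continuous_coe.comp (by fun_prop),
      by simp, by simp⟩

/-- Every point of the unit circle is joined to `(1, 0)` by a path in the circle. -/
theorem exists_continuous_unit_circle {y z : ℝ} (h : y ^ 2 + z ^ 2 = 1) :
    ∃ p q : ℝ → ℝ, Continuous p ∧ Continuous q ∧ (∀ t, p t ^ 2 + q t ^ 2 = 1) ∧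
      p 0 = 1 ∧ q 0 = 0 ∧ p 1 = y ∧ q 1 = z := by
  have hn : ‖(⟨y, z⟩ : ℂ)‖ = 1 := by
    rw [← sq_eq_sq₀ (norm_nonneg _) zero_le_one, Complex.sq_norm, Complex.normSq_mk]
    linarith
  refine ⟨fun t ↦ Real.cos (t * Complex.arg ⟨y, z⟩), fun t ↦ Real.sin (t * Complex.arg ⟨y, z⟩),
    by fun_prop, by fun_prop, fun t ↦ Real.cos_sq_add_sin_sq _, by simp, by simp, ?_, ?_⟩
  · have := Complex.norm_mul_cos_arg ⟨y, z⟩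
    simpa [hn] using this
  · have := Complex.norm_mul_sin_arg ⟨y, z⟩
    simpa [hn] using this

/-- The genus five surface
`Σ̂ = {(γ, θ, y, z) ∈ (ℝ/2πℤ)² × ℝ² : y² + z² = 1, sin γ · z = sin θ · y}`
is path-connected. -/
theorem genus_five_surface_pathConnected :
    IsPathConnected {x : Real.Angle × Real.Angle × ℝ × ℝ |
      x.2.2.1 ^ 2 + x.2.2.2 ^ 2 = 1 ∧
      Real.Angle.sin x.1 * x.2.2.2 = Real.Angle.sin x.2.1 * x.2.2.1} := by
  set S := {x : Real.Angle × Real.Angle × ℝ × ℝ |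
      x.2.2.1 ^ 2 + x.2.2.2 ^ 2 = 1 ∧
      Real.Angle.sin x.1 * x.2.2.2 = Real.Angle.sin x.2.1 * x.2.2.1} with hS
  have rotate : ∀ {γ θ : Real.Angle} {y z : ℝ}, γ.sin = 0 → θ.sin = 0 → y ^ 2 + z ^ 2 = 1 →
      JoinedIn S (γ, θ, 1, 0) (γ, θ, y, z) := by
    intro γ θ y z hγ hθ h
    obtain ⟨p, q, hp, hq, hpq, hp0, hq0, hp1, hq1⟩ := exists_continuous_unit_circle h
    refine JoinedIn.ofLine (f := fun t ↦ (γ, θ, p t, q t)) (by fun_prop)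
      (by simp [hp0, hq0]) (by simp [hp1, hq1]) ?_
    rintro _ ⟨t, -, rfl⟩
    simp [hS, hpq, hγ, hθ]
  have base : ∀ {γ θ : Real.Angle}, γ.sin = 0 → θ.sin = 0 →
      JoinedIn S (0, 0, 1, 0) (γ, θ, 1, 0) := by
    intro γ θ hγ hθ
    have h0 : Real.Angle.sin 0 = 0 := Real.Angle.sin_zero
    have moveθ : JoinedIn S (0, 0, 0, 1) (0, θ, 0, 1) := by
      obtain ⟨f, hf, hf0, hf1⟩ := θ.exists_continuous_zero_one
      refine JoinedIn.ofLine (f := fun t ↦ (0, f t, 0, 1)) (by fun_prop)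
        (by simp [hf0]) (by simp [hf1]) ?_
      rintro _ ⟨t, -, rfl⟩
      simp [hS]
    have moveγ : JoinedIn S (0, θ, 1, 0) (γ, θ, 1, 0) := by
      obtain ⟨f, hf, hf0, hf1⟩ := γ.exists_continuous_zero_one
      refine JoinedIn.ofLine (f := fun t ↦ (f t, θ, 1, 0)) (by fun_prop)
        (by simp [hf0]) (by simp [hf1]) ?_
      rintro _ ⟨t, -, rfl⟩
      simp [hS, hθ]
    exact (((rotate h0 h0 (by norm_num)).trans moveθ).trans
      (rotate h0 hθ (by norm_num)).symm).trans moveγ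
  refine ⟨(0, 0, 1, 0), by simp [hS], ?_⟩
  rintro ⟨γ, θ, y, z⟩ ⟨h, hsin⟩
  dsimp only at h hsin
  obtain ⟨f, hf, hf1, hfs⟩ := γ.exists_continuous_sin_eq_mul
  obtain ⟨g, hg, hg1, hgs⟩ := θ.exists_continuous_sin_eq_mul
  have hf0 : (f 0).sin = 0 := by simpa using hfs 0 (by simp)
  have hg0 : (g 0).sin = 0 := by simpa using hgs 0 (by simp)
  refine ((base hf0 hg0).trans (rotate hf0 hg0 h)).trans ?_
  refine JoinedIn.ofLine (f := fun t ↦ (f t, g t, y, z)) (by fun_prop) rfl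
    (by simp [hf1, hg1]) ?_
  rintro _ ⟨t, ht, rfl⟩
  refine ⟨h, ?_⟩
  dsimp only
  rw [hfs t ht, hgs t ht, mul_assoc, hsin, mul_assoc]
end
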